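/- Let (γ_n)_{n≥1} be nonzero complex numbers and let P_n be the monic polynomials defined by the threefold symmetric recurrence. Set ϑ₁ := 3(γ₁ + γ₂)/(4γ₂) and ϑ₂ := 3(γ₁ + γ₂)/(10γ₃) + 4/5, assume ϑ₁ ≠ (k−1)/k and ϑ₂ ≠ (k−1)/k for every integer k ≥ 1, and define ϑ_n for n ≥ 1 by the ϑ-recursion. Suppose that for every n ≥ 1 the polynomial P_n satisfies (a_n X³ − b_n)·P_n‴ + c_n X²·P_n″ + d_n X·P_n′ = e_n·P_n, where a_n = (ϑ_n − 1)(ϑ_{n+1} − 1), b_n = γ_n·((n−1)ϑ_{n−1} − n + 2)·(nϑ_n − n + 1)·((n+1)ϑ_{n+1} − n)/(n(n+1)) (the factor (n−1)ϑ_{n−1} − n + 2 being 1 when n = 1), c_n = ϑ_nϑ_{n+1} − 1 − (n−3)(ϑ_n − 1)(ϑ_{n+1} − 1), d_n = nϑ_{n+1} − (n−1)ϑ_n(2ϑ_{n+1} − 1), and e_n = nϑ_{n+1}. Then (n+1)·((n+4)(ϑ_{n+1} − 1) + 1)·γ_{n+2} = (n+3)·(n(ϑ_n − 1) + 1)·γ_{n+1}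 for all n ≥ 1; consequently the monic derivatives Q_n := P_{n+1}′/(n+1) satisfy Q_{n+1}(X) = X·Q_n(X) − γ̃_{n−1}·Q_{n−2}(X) for n ≥ 2 with γ̃_m = (m/(m+2))·ϑ_m·γ_{m+1} ≠ 0, i.e. {P_n} is Hahn-classical. -/

import Mathlib

open Polynomial

section Coefficients

variable {R : Type*} [CommRing R]

theorem coeff_X_mul_derivative (p : R[X]) (k : ℕ) :
    (X * derivative p).coeff k = k * p.coeff k := by
  cases k with
  | zero => simp
  | succ k => rw [coeff_X_mul, coeff_derivative]; push_cast; ring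

theorem coeff_X_sq_mul_derivative_two (p : R[X]) (k : ℕ) :
    (X ^ 2 * derivative (derivative p)).coeff k = k * (k - 1) * p.coeff k := by
  have h : X ^ 2 * derivative (derivative p)
      = X * derivative (X * derivative p) - X * derivative p := by
    simp only [derivative_mul, derivative_X]; ring
  rw [h, coeff_sub, coeff_X_mul_derivative, coeff_X_mul_derivative]; ring

theorem coeff_X_cube_mul_derivative_three (p : R[X]) (k : ℕ) :
    (X ^ 3 * derivative (derivative (derivative p))).coeff k
      = k * (k - 1) * (k - 2) * p.coeff k := by
  have h : X ^ 3 * derivative (derivative (derivative p))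
      = X * derivative (X ^ 2 * derivative (derivative p))
        - C 2 * (X ^ 2 * derivative (derivative p)) := by
    simp only [derivative_mul, derivative_X_pow, map_natCast, map_ofNat]; push_cast; ring
  rw [h, coeff_sub, coeff_C_mul, coeff_X_mul_derivative, coeff_X_sq_mul_derivative_two]; ring

theorem coeff_derivative_three (p : R[X]) (k : ℕ) :
    (derivative (derivative (derivative p))).coeff k
      = (k + 1) * (k + 2) * (k + 3) * p.coeff (k + 3) := by
  simp only [coeff_derivative]; push_cast; ring

/-- Threefold symmetric sequences are monic, with `P n` of degree `n`. -/
theorem threefold_coeff {γ : ℕ → R} {P : ℕ → R[X]}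
    (hP0 : P 0 = 1) (hP1 : P 1 = X) (hP2 : P 2 = X ^ 2)
    (hPrec : ∀ n : ℕ, P (n + 3) = X * P (n + 2) - C (γ (n + 1)) * P n) (n : ℕ) :
    (∀ m, n < m → (P n).coeff m = 0) ∧ (P n).coeff n = 1 := by
  induction n using Nat.strong_induction_on with
  | _ n ih =>
    match n with
    | 0 => exact ⟨fun m hm => by simp [hP0, coeff_one, hm.ne'], by simp [hP0]⟩
    | 1 => exact ⟨fun m hm => by simp [hP1, coeff_X, hm.ne], by simp [hP1]⟩
    | 2 => exact ⟨fun m hm => by simp [hP2, coeff_X_pow, hm.ne'], by simp [hP2]⟩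
    | n + 3 =>
      obtain ⟨h₂, h₂'⟩ := ih (n + 2) (by omega)
      obtain ⟨h₀, -⟩ := ih n (by omega)
      constructor
      · rintro (_ | m) hm
        · omega
        · rw [hPrec, coeff_sub, coeff_X_mul, coeff_C_mul, h₂ m (by omega), h₀ _ (by omega)]
          simp
      · rw [hPrec, coeff_sub, coeff_X_mul, coeff_C_mul, h₂', h₀ _ (by omega)]
        simp

theorem threefold_subleading_succ {γ : ℕ → R} {P : ℕ → R[X]}
    (hP0 : P 0 = 1) (hP1 : P 1 = X) (hP2 : P 2 = X ^ 2)
    (hPrec : ∀ n : ℕ, P (n + 3) = X * P (n + 2) - C (γ (n + 1)) * P n) (k : ℕ) :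
    (P (k + 4)).coeff (k + 1) = (P (k + 3)).coeff k - γ (k + 2) := by
  rw [hPrec (k + 1), coeff_sub, coeff_X_mul, coeff_C_mul,
    (threefold_coeff hP0 hP1 hP2 hPrec (k + 1)).2, mul_one]

end Coefficients

section Theta

variable {K : Type*} [Field K]

theorem natCast_mul_add_one_ne_zero [CharZero K] {u : K}
    (hu : ∀ k : ℕ, 1 ≤ k → u ≠ ((k : K) - 1) / k) (k : ℕ) : (k : K) * (u - 1) + 1 ≠ 0 := by
  rcases Nat.eq_zero_or_pos k with rfl | hk
  · simp
  · intro h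
    have hk' : (k : K) ≠ 0 := by exact_mod_cast hk.ne'
    exact hu k hk (by rw [eq_div_iff hk']; linear_combination h)

theorem theta_quotient_sub_one {u : K} {n : ℕ} (hn : (n : K) * (u - 1) + 1 ≠ 0) :
    (((n : K) + 1) * u - n) / ((n : K) * u - ((n : K) - 1)) - 1
      = (u - 1) / ((n : K) * (u - 1) + 1) := by
  have e : (n : K) * u - ((n : K) - 1) = (n : K) * (u - 1) + 1 := by ring
  rw [e, div_sub_one hn]; ring

/-- Every term of the `ϑ`-recursion is, up to a shift by one, `(u - 1) / (n (u - 1) + 1)`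
for one of the two initial values `u`. -/
theorem theta_sub_one_eq [CharZero K] {u₁ u₂ : K}
    (h1 : ∀ k : ℕ, 1 ≤ k → u₁ ≠ ((k : K) - 1) / k)
    (h2 : ∀ k : ℕ, 1 ≤ k → u₂ ≠ ((k : K) - 1) / k) {θ : ℕ → K}
    (hodd : ∀ n : ℕ, θ (2 * n + 1) =
      (((n : K) + 1) * u₁ - (n : K)) / ((n : K) * u₁ - ((n : K) - 1)))
    (heven : ∀ n : ℕ, θ (2 * n + 2) =
      (((n : K) + 1) * u₂ - (n : K)) / ((n : K) * u₂ - ((n : K) - 1))) (n : ℕ) :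
    ∃ (σ : K) (j : ℕ), (∀ k : ℕ, (k : K) * σ + 1 ≠ 0) ∧
      θ (n + 1) - 1 = σ / (j * σ + 1) ∧ θ (n + 3) - 1 = σ / (((j + 1 : ℕ) : K) * σ + 1) := by
  have n1 := natCast_mul_add_one_ne_zero h1
  have n2 := natCast_mul_add_one_ne_zero h2
  rcases Nat.even_or_odd' n with ⟨j, rfl | rfl⟩
  · refine ⟨u₁ - 1, j, n1, ?_, ?_⟩
    · rw [hodd, theta_quotient_sub_one (n1 j)]
    · rw [show 2 * j + 3 = 2 * (j + 1) + 1 by ring, hodd, theta_quotient_sub_one (n1 (j + 1))]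
  · refine ⟨u₂ - 1, j, n2, ?_, ?_⟩
    · rw [show 2 * j + 1 + 1 = 2 * j + 2 by ring, heven, theta_quotient_sub_one (n2 j)]
    · rw [show 2 * j + 1 + 3 = 2 * (j + 1) + 2 by ring, heven, theta_quotient_sub_one (n2 (j + 1))]

end Theta

/-- The structure relation between a threefold symmetric sequence and its derivatives. -/
theorem threefold_structure_relation {K : Type*} [Field K] [CharZero K]
    {γ θ : ℕ → K} {P : ℕ → K[X]}
    (hP0 : P 0 = 1) (hP1 : P 1 = X) (hP2 : P 2 = X ^ 2)
    (hPrec : ∀ n : ℕ, P (n + 3) = X * P (n + 2) - C (γ (n + 1)) * P n)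
    (hθ : ∀ n : ℕ, θ (n + 3) * θ (n + 1) = 2 * θ (n + 1) - 1)
    (h0 : 3 * γ 1 = (4 * (θ 1 - 1) + 1) * γ 2)
    (hrec : ∀ n : ℕ, ((n : K) + 2) * (((n : K) + 5) * (θ (n + 2) - 1) + 1) * γ (n + 3) =
        ((n : K) + 4) * (((n : K) + 1) * (θ (n + 1) - 1) + 1) * γ (n + 2)) (n : ℕ) :
    ((n : K[X]) + 3) * P (n + 3) - X * derivative (P (n + 3))
      + C ((((n : K) + 4) * (θ (n + 1) - 1) + 1) * γ (n + 2)) * derivative (P (n + 1)) = 0 := by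
  have hP3 : P 3 = X ^ 3 - C (γ 1) := by rw [hPrec 0, hP0, hP2]; ring
  have hP4 : P 4 = X ^ 4 - C (γ 1 + γ 2) * X := by
    rw [hPrec 1, hP1, hP3, C_add]; ring
  have hP5 : P 5 = X ^ 5 - C (γ 1 + γ 2 + γ 3) * X ^ 2 := by
    rw [hPrec 2, hP2, hP4, C_add, C_add, C_add]; ring
  have h1 := congrArg C (hrec 0)
  have h2 := congrArg C (hrec 1)
  replace h0 := congrArg C h0
  induction n using Nat.strong_induction_on with
  | _ n ih =>
    match n with
    | 0 =>
      simp only [map_mul, map_add, map_sub, map_one, map_ofNat] at h0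
      simp [hP3, hP1]
      simp only [map_ofNat]
      linear_combination -h0
    | 1 =>
      simp only [map_mul, map_add, map_sub, map_one, map_ofNat, map_natCast] at h0 h1
      simp [hP4, hP2]
      simp only [map_ofNat]
      push_cast at h1 ⊢
      linear_combination X * (-h0 + h1)
    | 2 =>
      simp only [map_mul, map_add, map_sub, map_one, map_ofNat, map_natCast] at h0 h1 h2
      simp [hP5, hP3]
      simp only [map_ofNat]
      push_cast at h1 h2 ⊢
      linear_combination X ^ 2 * (-h0 + h1 + h2)
    | n + 3 =>
      have s₂ := ih (n + 2) (by omega)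
      have s₀ := ih n (by omega)
      have r₂ := hrec (n + 2)
      have n3 : ((n : K[X]) + 3) ≠ 0 := by exact_mod_cast (by omega : n + 3 ≠ 0)
      have n4 : ((n : K) + 4) ≠ 0 := by exact_mod_cast (by omega : n + 4 ≠ 0)
      have p₃ := hPrec (n + 3)
      have p₁ := hPrec (n + 1)
      have d₃ := congrArg derivative p₃
      have d₁ := congrArg derivative p₁
      simp only [derivative_sub, derivative_mul, derivative_X, derivative_C] at d₃ d₁
      simp only [Nat.add_assoc, Nat.reduceAdd] at *
      push_cast at s₂ r₂ ⊢
      have E₁ : -((n : K) + 3) * ((((n : K) + 2 + 4) * (θ (n + 3) - 1) + 1) * γ (n + 4))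
          - 3 * γ (n + 4)
          + ((n : K) + 4) * ((((n : K) + 3 + 4) * (θ (n + 4) - 1) + 1) * γ (n + 5)) = 0 := by
        linear_combination r₂
      have E₂ : γ (n + 4) * ((((n : K) + 4) * (θ (n + 1) - 1) + 1) * γ (n + 2)) * ((n : K) + 6)
          - ((((n : K) + 3 + 4) * (θ (n + 4) - 1) + 1) * γ (n + 5)) *
            (((n : K) + 3) * γ (n + 2)
              + (((n : K) + 4) * (θ (n + 1) - 1) + 1) * γ (n + 2)) = 0 := by
        apply mul_left_cancel₀ n4
        linear_combination -(((n : K) + 4) * θ (n + 1) * γ (n + 2)) * r₂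
          - ((n : K) + 6) * ((n : K) + 4) * ((n : K) + 3) * γ (n + 4) * γ (n + 2) * hθ n
      generalize (((n : K) + 2 + 4) * (θ (n + 3) - 1) + 1) * γ (n + 4) = k₂ at *
      generalize (((n : K) + 3 + 4) * (θ (n + 4) - 1) + 1) * γ (n + 5) = k₃ at *
      generalize (((n : K) + 4) * (θ (n + 1) - 1) + 1) * γ (n + 2) = k₀ at *
      replace E₁ := congrArg C E₁
      replace E₂ := congrArg C E₂
      simp only [map_mul, map_add, map_sub, map_neg, map_ofNat, map_natCast, map_zero] at E₁ E₂
      apply mul_left_cancel₀ n3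
      rw [d₃, p₃, d₁]
      linear_combination ((n : K[X]) + 3) * X * s₂
        + (-((n : K[X]) + 3) * C (γ (n + 4)) + C k₃ - 3 * C (γ (n + 4))) * s₀
        + X * derivative (P (n + 3)) * E₁ + derivative (P (n + 1)) * E₂

/-- Bochner-type converse: if a threefold symmetric 2-orthogonal
sequence satisfies the third order differential equation, then the
γ-coefficients satisfy the Hahn-classical recursion, and the monic derivatives
form a threefold symmetric three-term sequence with nonzero coefficients, i.e.
the sequence is Hahn-classical. -/
theorem third_order_ode_implies_hahn_classical
    (γ : ℕ → ℂ) (hγ : ∀ n : ℕ, 1 ≤ n → γ n ≠ 0)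
    (P : ℕ → Polynomial ℂ)
    (hP0 : P 0 = 1) (hP1 : P 1 = X) (hP2 : P 2 = X ^ 2)
    (hPrec : ∀ n : ℕ, P (n + 3) = X * P (n + 2) - C (γ (n + 1)) * P n)
    (ϑ₁ ϑ₂ : ℂ)
    (hϑ₁def : ϑ₁ = 3 * (γ 1 + γ 2) / (4 * γ 2))
    (hϑ₂def : ϑ₂ = 3 * (γ 1 + γ 2) / (10 * γ 3) + 4 / 5)
    (h1 : ∀ k : ℕ, 1 ≤ k → ϑ₁ ≠ ((k : ℂ) - 1) / k)
    (h2 : ∀ k : ℕ, 1 ≤ k → ϑ₂ ≠ ((k : ℂ) - 1) / k)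
    (θ : ℕ → ℂ)
    (hθodd : ∀ n : ℕ, θ (2 * n + 1) =
      (((n : ℂ) + 1) * ϑ₁ - (n : ℂ)) / ((n : ℂ) * ϑ₁ - ((n : ℂ) - 1)))
    (hθeven : ∀ n : ℕ, θ (2 * n + 2) =
      (((n : ℂ) + 1) * ϑ₂ - (n : ℂ)) / ((n : ℂ) * ϑ₂ - ((n : ℂ) - 1)))
    (hODE : ∀ n : ℕ, 1 ≤ n →
      (C ((θ n - 1) * (θ (n + 1) - 1)) * X ^ 3
          - C (γ n * (((n : ℂ) - 1) * θ (n - 1) - (n : ℂ) + 2) *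
               ((n : ℂ) * θ n - (n : ℂ) + 1) * (((n : ℂ) + 1) * θ (n + 1) - (n : ℂ)) /
               ((n : ℂ) * ((n : ℂ) + 1))))
        * derivative (derivative (derivative (P n)))
      + C (θ n * θ (n + 1) - 1 - ((n : ℂ) - 3) * (θ n - 1) * (θ (n + 1) - 1)) * X ^ 2
        * derivative (derivative (P n))
      + C ((n : ℂ) * θ (n + 1) - ((n : ℂ) - 1) * θ n * (2 * θ (n + 1) - 1)) * X
        * derivative (P n)
      = C ((n : ℂ) * θ (n + 1)) * P n)
    (Q : ℕ → Polynomial ℂ)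
    (hQdef : ∀ n : ℕ, Q n = C (((n : ℂ) + 1)⁻¹) * derivative (P (n + 1))) :
    (∀ n : ℕ, 1 ≤ n →
      ((n : ℂ) + 1) * (((n : ℂ) + 4) * (θ (n + 1) - 1) + 1) * γ (n + 2) =
        ((n : ℂ) + 3) * ((n : ℂ) * (θ n - 1) + 1) * γ (n + 1)) ∧
    (∀ n : ℕ, Q (n + 3) = X * Q (n + 2)
        - C ((((n : ℂ) + 1) / ((n : ℂ) + 3)) * θ (n + 1) * γ (n + 2)) * Q n) ∧
    (∀ m : ℕ, 1 ≤ m → ((m : ℂ) / ((m : ℂ) + 2)) * θ m * γ (m + 1) ≠ 0) := by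
  have hθ : ∀ n : ℕ, θ (n + 3) * θ (n + 1) = 2 * θ (n + 1) - 1 := by
    intro n
    obtain ⟨σ, j, hσ, e₁, e₂⟩ := theta_sub_one_eq h1 h2 hθodd hθeven n
    have d₁ := hσ j
    have d₂ := hσ (j + 1)
    rw [eq_div_iff d₁] at e₁
    rw [eq_div_iff d₂] at e₂
    apply mul_left_cancel₀ (mul_ne_zero d₁ d₂)
    push_cast at e₂ ⊢
    linear_combination (θ (n + 1) * (j * σ + 1)) * e₂ - (j * σ + 1) * e₁
  have hne : ∀ n m : ℕ, (m : ℂ) * (θ (n + 1) - 1) + 1 ≠ 0 := by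
    intro n m
    obtain ⟨σ, j, hσ, e₁, -⟩ := theta_sub_one_eq h1 h2 hθodd hθeven n
    have hj := hσ j
    have hmj := hσ (m + j)
    rw [e₁, mul_div_assoc', div_add_one hj]
    refine div_ne_zero ?_ hj
    push_cast at hmj
    convert hmj using 1
    ring
  have hθ0 : ∀ n : ℕ, θ (n + 1) ≠ 0 := by
    intro n
    simpa using hne n 1
  have hbase : 3 * γ 1 = (4 * (θ 1 - 1) + 1) * γ 2 := by
    have hθ1 : θ 1 = ϑ₁ := by simpa using hθodd 0
    have := hγ 2 (by norm_num)
    rw [hθ1, hϑ₁def]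
    field_simp
    ring
  have hstar : ∀ k : ℕ, γ (k + 3) * ((k : ℂ) + 2) * ((k : ℂ) + 1) *
      (((k : ℂ) + 4) * (θ (k + 1) - 1) + 1) * (((k : ℂ) + 5) * (θ (k + 2) - 1) + 1) =
      -3 * ((k : ℂ) + 4) * (P (k + 3)).coeff k * (((k : ℂ) + 1) * (θ (k + 1) - 1) + 1) := by
    intro k
    have ode := congrArg (fun p => coeff p k) (hODE (k + 3) (by omega))
    simp only [sub_mul, mul_assoc (C _), coeff_add, coeff_sub, coeff_C_mul,
      coeff_X_mul_derivative, coeff_X_sq_mul_derivative_two, coeff_X_cube_mul_derivative_three,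
      coeff_derivative_three, (threefold_coeff hP0 hP1 hP2 hPrec (k + 3)).2] at ode
    have e₁ := hθ k
    have e₂ := hθ (k + 1)
    have x0 := hθ0 k
    have y0 := hθ0 (k + 1)
    have f0 := hne (k + 1) (k + 2)
    have k3 : (k : ℂ) + 3 ≠ 0 := by exact_mod_cast (by omega : k + 3 ≠ 0)
    have k4 : (k : ℂ) + 4 ≠ 0 := by exact_mod_cast (by omega : k + 4 ≠ 0)
    rw [show k + 3 - 1 = k + 2 by omega] at ode
    simp only [show k + 1 + 3 = k + 4 by omega, show k + 1 + 1 = k + 2 by omega] at ode e₂ y0 f0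
    push_cast at ode f0
    have e₁' : θ (k + 3) = 2 - 1 / θ (k + 1) := by field_simp; linear_combination e₁
    have e₂' : θ (k + 4) = 2 - 1 / θ (k + 2) := by field_simp; linear_combination e₂
    rw [e₁', e₂'] at ode
    generalize θ (k + 1) = x at *
    generalize θ (k + 2) = y at *
    generalize (P (k + 3)).coeff k = c at *
    have k5 : (k : ℂ) + 3 + 1 ≠ 0 := by convert k4 using 1; ring
    apply mul_left_cancel₀ f0
    field_simp at ode
    linear_combination -ode
  have hrec : ∀ k : ℕ,
      -3 * (P (k + 3)).coeff k
        = ((k : ℂ) + 1) * (((k : ℂ) + 4) * (θ (k + 1) - 1) + 1) * γ (k + 2) ∧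
      ((k : ℂ) + 2) * (((k : ℂ) + 5) * (θ (k + 2) - 1) + 1) * γ (k + 3) =
        ((k : ℂ) + 4) * (((k : ℂ) + 1) * (θ (k + 1) - 1) + 1) * γ (k + 2) := by
    have step : ∀ k : ℕ, -3 * (P (k + 3)).coeff k
        = ((k : ℂ) + 1) * (((k : ℂ) + 4) * (θ (k + 1) - 1) + 1) * γ (k + 2) →
      ((k : ℂ) + 2) * (((k : ℂ) + 5) * (θ (k + 2) - 1) + 1) * γ (k + 3) =
        ((k : ℂ) + 4) * (((k : ℂ) + 1) * (θ (k + 1) - 1) + 1) * γ (k + 2) := by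
      intro k hk
      have a0 := hne k (k + 4)
      have k1 : (k : ℂ) + 1 ≠ 0 := by exact_mod_cast (by omega : k + 1 ≠ 0)
      push_cast at a0
      apply mul_left_cancel₀ (mul_ne_zero k1 a0)
      linear_combination hstar k + ((k : ℂ) + 4) * (((k : ℂ) + 1) * (θ (k + 1) - 1) + 1) * hk
    intro k
    induction k with
    | zero =>
      have : -3 * (P (0 + 3)).coeff 0
          = (((0 : ℕ) : ℂ) + 1) * ((((0 : ℕ) : ℂ) + 4) * (θ (0 + 1) - 1) + 1) * γ (0 + 2) := by
        rw [hPrec 0, hP0]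
        simp
        linear_combination hbase
      exact ⟨this, step 0 this⟩
    | succ k ih =>
      have : -3 * (P (k + 1 + 3)).coeff (k + 1) = (((k + 1 : ℕ) : ℂ) + 1) *
          ((((k + 1 : ℕ) : ℂ) + 4) * (θ (k + 1 + 1) - 1) + 1) * γ (k + 1 + 2) := by
        rw [show k + 1 + 3 = k + 4 by ring, threefold_subleading_succ hP0 hP1 hP2 hPrec]
        push_cast
        linear_combination ih.1 - ih.2
      exact ⟨this, step (k + 1) this⟩
  have hS := threefold_structure_relation hP0 hP1 hP2 hPrec hθ hbase (fun n => (hrec n).2)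
  refine ⟨?_, ?_, ?_⟩
  · rintro (_ | n) hn
    · omega
    · have := (hrec n).2
      push_cast
      linear_combination this
  · intro n
    have d := congrArg derivative (hPrec (n + 1))
    simp only [derivative_sub, derivative_mul, derivative_X, derivative_C] at d
    have s := hS n
    have n1 : (n : ℂ) + 1 ≠ 0 := by exact_mod_cast (by omega : n + 1 ≠ 0)
    have n3 : (n : ℂ) + 3 ≠ 0 := by exact_mod_cast (by omega : n + 3 ≠ 0)
    have n4 : (n : ℂ) + 4 ≠ 0 := by exact_mod_cast (by omega : n + 4 ≠ 0)
    simp only [Nat.add_assoc, Nat.reduceAdd] at d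
    have q₃ : C ((n : ℂ) + 4) * Q (n + 3) = derivative (P (n + 4)) := by
      rw [hQdef, ← mul_assoc, ← C_mul]
      push_cast
      rw [show (n : ℂ) + 3 + 1 = n + 4 by ring, mul_inv_cancel₀ n4, C_1, one_mul]
    have q₂ : C ((n : ℂ) + 3) * Q (n + 2) = derivative (P (n + 3)) := by
      rw [hQdef, ← mul_assoc, ← C_mul]
      push_cast
      rw [show (n : ℂ) + 2 + 1 = n + 3 by ring, mul_inv_cancel₀ n3, C_1, one_mul]
    have q₀ : C ((n : ℂ) + 1) * Q n = derivative (P (n + 1)) := by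
      rw [hQdef, ← mul_assoc, ← C_mul, mul_inv_cancel₀ n1, C_1, one_mul]
    have t : C ((n : ℂ) + 3) * C (((n : ℂ) + 1) / ((n : ℂ) + 3) * θ (n + 1) * γ (n + 2))
        = C ((n : ℂ) + 1) * C (θ (n + 1)) * C (γ (n + 2)) := by
      simp only [← C_mul]
      congr 1
      field_simp
    apply mul_left_cancel₀ (mul_ne_zero (C_ne_zero.mpr n3) (C_ne_zero.mpr n4))
    rw [← q₃, ← q₂, ← q₀] at d
    rw [← q₂, ← q₀] at s
    simp only [map_mul, map_add, map_sub, map_one, map_ofNat, map_natCast] at d s t ⊢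
    linear_combination ((n : ℂ[X]) + 3) * d + s + ((n : ℂ[X]) + 4) * Q n * t
  · rintro (_ | m) hm
    · omega
    · have hm1 : ((m + 1 : ℕ) : ℂ) ≠ 0 := by exact_mod_cast (by omega : m + 1 ≠ 0)
      have hm3 : ((m + 1 : ℕ) : ℂ) + 2 ≠ 0 := by exact_mod_cast (by omega : m + 1 + 2 ≠ 0)
      exact mul_ne_zero (mul_ne_zero (div_ne_zero hm1 hm3) (hθ0 m)) (hγ _ (by omega))
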